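/- arXiv:2601.22819 — 8 statements merged into one kernel-verified Lean document; each statement's English description precedes it below -/
import Mathlib

section
/- For every real number κ and every real τ > 0, the set {z - κ·exp(-zτ) : z ∈ ℂ} equals ℂ; equivalently, the entire function z ↦ z - κ·exp(-τz) is surjective from ℂ onto ℂ. -/
open Filter Metric in
/-- A closed ball lying high in the upper half plane contains a fixed point of `u ↦ C - log u`,
where `C` is its centre. -/
theorem Complex.exists_add_log_eq {C : ℂ} (hC : 2 ≤ C.im)
    (hlog : Real.log (‖C‖ + (C.im - 2)) + Real.pi ≤ C.im - 2) :
    ∃ u : ℂ, u ≠ 0 ∧ u + Complex.log u = C := by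
  set R := C.im - 2 with hR
  have him : ∀ u ∈ closedBall C R, 2 ≤ u.im := by
    intro u hu
    have h1 : ‖u - C‖ ≤ R := mem_closedBall_iff_norm.mp hu
    have h2 := (abs_le.mp ((Complex.abs_im_le_norm (u - C)).trans h1)).1
    rw [Complex.sub_im] at h2
    linarith
  have hnorm : ∀ u ∈ closedBall C R, 2 ≤ ‖u‖ := fun u hu =>
    (him u hu).trans (Complex.im_le_norm u)
  have hmaps : Set.MapsTo (fun u => C - Complex.log u) (closedBall C R) (closedBall C R) := by
    intro u hu
    have h1 : ‖u - C‖ ≤ R := mem_closedBall_iff_norm.mp hu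
    have h2 := hnorm u hu
    have h3 : ‖u‖ ≤ ‖C‖ + R := by linarith [norm_sub_norm_le u C]
    have h4 : Real.log ‖u‖ ≤ Real.log (‖C‖ + R) := Real.log_le_log (by linarith) h3
    have h5 := Complex.norm_le_abs_re_add_abs_im (Complex.log u)
    rw [Complex.log_re, Complex.log_im, abs_of_nonneg (Real.log_nonneg (by linarith))] at h5
    rw [mem_closedBall_iff_norm, sub_sub_cancel_left, norm_neg]
    linarith [Complex.abs_arg_le_pi u]
  have hderiv : ∀ u ∈ closedBall C R,
      HasDerivWithinAt (fun u => C - Complex.log u) (-u⁻¹) (closedBall C R) u := by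
    intro u hu
    have hslit : u ∈ Complex.slitPlane := .inr (by linarith [him u hu] : 0 < u.im).ne'
    exact ((Complex.hasDerivAt_log hslit).const_sub C).hasDerivWithinAt
  have hlip : LipschitzOnWith (1 / 2) (fun u => C - Complex.log u) (closedBall C R) := by
    refine (convex_closedBall C R).lipschitzOnWith_of_nnnorm_hasDerivWithin_le hderiv
      fun u hu => ?_
    rw [← NNReal.coe_le_coe, coe_nnnorm, norm_neg, norm_inv]
    simpa using inv_anti₀ two_pos (hnorm u hu)
  have hcontr : ContractingWith (1 / 2) (hmaps.restrict _ _ _) :=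
    ⟨by rw [← NNReal.coe_lt_coe]; norm_num, hlip.mapsToRestrict hmaps⟩
  obtain ⟨u, hu, hfix, -⟩ := hcontr.exists_fixedPoint' isClosed_closedBall.isComplete hmaps
    (mem_closedBall_self (by linarith)) (edist_ne_top C _)
  have hfix : C - Complex.log u = u := hfix
  exact ⟨u, norm_pos_iff.mp (by linarith [hnorm u hu]), by linear_combination -hfix⟩

open Filter in
/-- Every nonzero complex number is a value of `u ↦ u * exp u`. -/
theorem Complex.exists_mul_exp_eq {c : ℂ} (hc : c ≠ 0) : ∃ u : ℂ, u * Complex.exp u = c := by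
  set L := Complex.log c
  have hsmall : ∀ᶠ x : ℝ in atTop, Real.log x ≤ x / 4 := by
    filter_upwards [Real.isLittleO_log_id_atTop.bound (by norm_num : (0 : ℝ) < 1 / 4),
      eventually_ge_atTop 0] with x hx hx0
    rw [id, Real.norm_of_nonneg hx0] at hx
    linarith [Real.le_norm_self (Real.log x)]
  have htop : Tendsto (fun k : ℕ => L.im + 2 * Real.pi * k) atTop atTop :=
    tendsto_atTop_add_const_left _ _
      (tendsto_natCast_atTop_atTop.const_mul_atTop Real.two_pi_pos)
  obtain ⟨x₀, hx₀⟩ := eventually_atTop.mp hsmall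
  obtain ⟨k, hk2, hkx, hkL⟩ := ((htop.eventually_ge_atTop 2).and
    ((htop.eventually_ge_atTop (x₀ + 2)).and
      (htop.eventually_ge_atTop (|L.re| + 2 * Real.pi + 4)))).exists
  set C : ℂ := L + k * (2 * Real.pi * Complex.I) with hCdef
  have hre : C.re = L.re := by simp [hCdef]
  have him : C.im = L.im + 2 * Real.pi * k := by simp [hCdef]; ring
  rw [← him] at hk2 hkx hkL
  have hle := Complex.norm_le_abs_re_add_abs_im C
  rw [hre, abs_of_nonneg (by linarith : 0 ≤ C.im)] at hle
  have hge := Complex.im_le_norm C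
  have hlog := hx₀ (‖C‖ + (C.im - 2)) (by linarith [abs_nonneg L.re, Real.pi_pos])
  obtain ⟨u, hu, huC⟩ := Complex.exists_add_log_eq hk2 (by linarith [abs_nonneg L.re, Real.pi_pos])
  refine ⟨u, ?_⟩
  calc u * Complex.exp u = Complex.exp (u + Complex.log u) := by
        rw [Complex.exp_add, Complex.exp_log hu, mul_comm]
    _ = c := by
        rw [huC, hCdef, Complex.exp_add, Complex.exp_nat_mul_two_pi_mul_I, mul_one,
          Complex.exp_log hc]

/-- Lemma 3.1: for every real `κ` and every real `τ > 0`, the entire function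
`z ↦ z - κ·exp(-τz)` is surjective from `ℂ` onto `ℂ`; equivalently
`{z - κ·exp(-zτ) : z ∈ ℂ} = ℂ`. -/
theorem stmt_0 (κ τ : ℝ) (hτ : 0 < τ) :
    Set.range (fun z : ℂ => z - (κ : ℂ) * Complex.exp (-(z * (τ : ℂ)))) = Set.univ := by
  refine Set.range_eq_univ.mpr fun w => ?_
  rcases eq_or_ne κ 0 with rfl | hκ
  · exact ⟨w, by simp⟩
  have hτ' : (τ : ℂ) ≠ 0 := Complex.ofReal_ne_zero.mpr hτ.ne'
  have hκ' : (κ : ℂ) ≠ 0 := Complex.ofReal_ne_zero.mpr hκ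
  obtain ⟨u, hu⟩ := Complex.exists_mul_exp_eq
    (mul_ne_zero (mul_ne_zero hκ' hτ') (Complex.exp_ne_zero (-(w * τ))))
  have hexp : Complex.exp u * Complex.exp (-u) = 1 := by
    rw [← Complex.exp_add, add_neg_cancel, Complex.exp_zero]
  have hu' : u = κ * τ * (Complex.exp (-(w * τ)) * Complex.exp (-u)) := by
    linear_combination Complex.exp (-u) * hu - u * hexp
  refine ⟨w + u / τ, ?_⟩
  have harg : -((w + u / τ) * τ) = -(w * τ) + -u := by
    field_simp
    ring
  simp only [harg, Complex.exp_add]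
  field_simp
  linear_combination hu'
end

section
/- For every real number κ and every real τ > 0, ℂ is contained in the set {z - κ·exp(zτ) : z ∈ ℂ}; equivalently, the entire function z ↦ z - κ·exp(τz) is surjective from ℂ onto ℂ. -/
/-- Adding `b` to the logarithm is a contraction of the half-plane `2 ≤ im u`, provided that
`2 ≤ im b`; hence it has a fixed point. -/
theorem exists_log_add_eq_self {b : ℂ} (hb : 2 ≤ b.im) :
    ∃ u : ℂ, u ≠ 0 ∧ Complex.log u + b = u := by
  let S : Set ℂ := {u | 2 ≤ u.im}
  have hmaps : Set.MapsTo (fun u ↦ Complex.log u + b) S S := by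
    intro u (hu : 2 ≤ u.im)
    have harg : 0 ≤ u.arg := Complex.arg_nonneg_iff.2 (by linarith)
    change 2 ≤ (Complex.log u + b).im
    rw [Complex.add_im, Complex.log_im]
    linarith
  have hderiv : ∀ u ∈ S, HasDerivWithinAt (fun u ↦ Complex.log u + b) u⁻¹ S u := by
    intro u (hu : 2 ≤ u.im)
    have hslit : u ∈ Complex.slitPlane := Or.inr (by linarith)
    exact ((Complex.hasDerivAt_log hslit).add_const b).hasDerivWithinAt
  have hbound : ∀ u ∈ S, ‖u⁻¹‖₊ ≤ (2⁻¹ : NNReal) := by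
    intro u (hu : 2 ≤ u.im)
    rw [← NNReal.coe_le_coe, coe_nnnorm, norm_inv, NNReal.coe_inv, NNReal.coe_ofNat]
    have := (le_abs_self u.im).trans (Complex.abs_im_le_norm u)
    gcongr
    linarith
  have hlip : LipschitzOnWith 2⁻¹ (fun u ↦ Complex.log u + b) S :=
    (convex_halfSpace_im_ge 2).lipschitzOnWith_of_nnnorm_hasDerivWithin_le hderiv hbound
  have hcontr : ContractingWith 2⁻¹ (hmaps.restrict _ S S) :=
    ⟨by rw [← NNReal.coe_lt_coe]; norm_num, hlip.mapsToRestrict hmaps⟩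
  have hS : IsComplete S := (isClosed_le continuous_const Complex.continuous_im).isComplete
  obtain ⟨u, hu, hfix, -⟩ := hcontr.exists_fixedPoint' hS hmaps (x := b) hb (edist_ne_top _ _)
  refine ⟨u, ?_, hfix⟩
  rintro rfl
  norm_num [S] at hu

theorem exists_eq_mul_exp (c : ℂ) : ∃ u : ℂ, u = c * Complex.exp u := by
  rcases eq_or_ne c 0 with rfl | hc
  · exact ⟨0, by simp⟩
  have hb : 2 ≤ (2 * Real.pi * Complex.I - Complex.log c).im := by
    have hπ := Real.pi_gt_three
    have harg := Complex.arg_le_pi c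
    simp [Complex.log_im]
    linarith
  obtain ⟨u, hu, hfix⟩ := exists_log_add_eq_self hb
  refine ⟨u, ?_⟩
  rw [← hfix, Complex.exp_add, Complex.exp_sub, Complex.exp_two_pi_mul_I, Complex.exp_log hu,
    Complex.exp_log hc, hfix]
  field_simp


/-- For every real `κ` and every real `τ > 0`, `ℂ ⊆ {z - κ·exp(zτ) : z ∈ ℂ}`;
equivalently `z ↦ z - κ·exp(τz)` is surjective. -/
theorem stmt_1 (κ τ : ℝ) (hτ : 0 < τ) :
    (Set.univ : Set ℂ) ⊆ {w : ℂ | ∃ z : ℂ, z - (κ : ℂ) * Complex.exp (z * (τ : ℂ)) = w} := by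
  intro w _
  have hτ' : (τ : ℂ) ≠ 0 := by exact_mod_cast hτ.ne'
  obtain ⟨u, hu⟩ := exists_eq_mul_exp (τ * κ * Complex.exp (w * τ))
  refine ⟨w + u / τ, ?_⟩
  rw [add_mul, div_mul_cancel₀ _ hτ', Complex.exp_add]
  have hdiv : u / τ = κ * (Complex.exp (w * τ) * Complex.exp u) := by
    rw [div_eq_iff hτ']
    linear_combination hu
  rw [hdiv]
  ring
end

section
/- Let κ be a nonzero real number, τ > 0, and η₁, η₂ ∈ ℝ, and set a := κ·τ·exp(-η₁τ) (a real number). If ξ₁, ξ₂ ∈ ℝ satisfy ξ₁·exp(ξ₁) = a·cos(ξ₂ - η₂τ) and ξ₂·exp(ξ₁) = -a·sin(ξ₂ - η₂τ), then the complex number z := (η₁ + ξ₁/τ) + i(η₂ - ξ₂/τ) satisfies z - κ·exp(-τz) = η₁ + i·η₂. -/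
/-- Reduction step in the proof of Lemma 3.1: if `(ξ₁, ξ₂)` solves the real system
`ξ₁ e^{ξ₁} = a cos(ξ₂ - η₂τ)`, `ξ₂ e^{ξ₁} = -a sin(ξ₂ - η₂τ)` with
`a := κτe^{-η₁τ}`, then `z := (η₁ + ξ₁/τ) + i(η₂ - ξ₂/τ)` solves
`z - κ e^{-τz} = η₁ + iη₂`. -/
theorem stmt_2 (κ τ η₁ η₂ : ℝ) (hκ : κ ≠ 0) (hτ : 0 < τ)
    (a : ℝ) (ha : a = κ * τ * Real.exp (-η₁ * τ))
    (ξ₁ ξ₂ : ℝ)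
    (h1 : ξ₁ * Real.exp ξ₁ = a * Real.cos (ξ₂ - η₂ * τ))
    (h2 : ξ₂ * Real.exp ξ₁ = -a * Real.sin (ξ₂ - η₂ * τ)) :
    (((η₁ + ξ₁ / τ : ℝ) : ℂ) + ((η₂ - ξ₂ / τ : ℝ) : ℂ) * Complex.I) -
        (κ : ℂ) * Complex.exp (-((τ : ℂ) * (((η₁ + ξ₁ / τ : ℝ) : ℂ) +
          ((η₂ - ξ₂ / τ : ℝ) : ℂ) * Complex.I))) =
      (η₁ : ℂ) + (η₂ : ℂ) * Complex.I := by
  have hτ' : τ ≠ 0 := hτ.ne'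
  have hexp : Real.exp (-(η₁ * τ + ξ₁)) * Real.exp ξ₁ = Real.exp (-η₁ * τ) := by
    rw [← Real.exp_add]
    ring_nf
  have hre : ξ₁ / τ = κ * (Real.exp (-(η₁ * τ + ξ₁)) * Real.cos (ξ₂ - η₂ * τ)) := by
    rw [div_eq_iff hτ']
    apply mul_right_cancel₀ (Real.exp_ne_zero ξ₁)
    rw [h1, ha, ← hexp]
    ring
  have him : -(ξ₂ / τ) = κ * (Real.exp (-(η₁ * τ + ξ₁)) * Real.sin (ξ₂ - η₂ * τ)) := by
    rw [← neg_div, div_eq_iff hτ']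
    apply mul_right_cancel₀ (Real.exp_ne_zero ξ₁)
    rw [neg_mul, h2, ha, ← hexp]
    ring
  have harg : -((τ : ℂ) * (((η₁ + ξ₁ / τ : ℝ) : ℂ) + ((η₂ - ξ₂ / τ : ℝ) : ℂ) * Complex.I)) =
      ((-(η₁ * τ + ξ₁) : ℝ) : ℂ) + ((ξ₂ - η₂ * τ : ℝ) : ℂ) * Complex.I := by
    have hτc : (τ : ℂ) ≠ 0 := Complex.ofReal_ne_zero.mpr hτ'
    push_cast
    field_simp
    ring
  rw [harg, Complex.exp_add, Complex.exp_mul_I, ← Complex.ofReal_exp, ← Complex.ofReal_cos,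
    ← Complex.ofReal_sin, sub_eq_add_neg η₂, him, hre]
  push_cast
  ring
end

section
/- For every nonzero real number a and every b ∈ ℝ, there exist real numbers ξ₁ < 0 and ξ₂ > 0 such that ξ₁·exp(ξ₁) = a·cos(ξ₂ - b) and ξ₂·exp(ξ₁) = -a·sin(ξ₂ - b). -/
/-- The curve along which both trigonometric equations have the same phase meets the modulus
condition, as soon as the phase `c` is large compared to `a` and `a⁻¹`. -/
theorem exists_modulus_eq {a c : ℝ} (ha : 0 < a) (hc : a + 4 / a ≤ c) :
    ∃ s : ℝ, 0 < Real.sin s ∧ 0 < Real.cos s ∧ 0 < c + s ∧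
      (c + s) * Real.exp (-(c + s) * (Real.cos s / Real.sin s)) = a * Real.sin s := by
  have hπ := Real.pi_pos
  have h4 : 0 < 4 / a := by positivity
  have hsin : ∀ s ∈ Set.Icc (Real.pi / 4) (Real.pi / 2), 0 < Real.sin s := fun s hs =>
    Real.sin_pos_of_pos_of_lt_pi (by linarith [hs.1]) (by linarith [hs.2])
  let F : ℝ → ℝ := fun s =>
    (c + s) * Real.exp (-(c + s) * (Real.cos s / Real.sin s)) - a * Real.sin s
  have hF : ContinuousOn F (Set.Icc (Real.pi / 4) (Real.pi / 2)) := by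
    have hcot : ContinuousOn (fun s => Real.cos s / Real.sin s)
        (Set.Icc (Real.pi / 4) (Real.pi / 2)) :=
      Real.continuous_cos.continuousOn.div Real.continuous_sin.continuousOn
        fun s hs => (hsin s hs).ne'
    fun_prop
  have hleft : F (Real.pi / 4) ≤ 0 := by
    have hne : √2 / 2 ≠ 0 := by positivity
    simp only [F, Real.cos_pi_div_four, Real.sin_pi_div_four, div_self hne, mul_one]
    set x := c + Real.pi / 4 with hx
    have hx0 : 0 < x := by linarith
    have hax : 4 ≤ a * x := by
      have : 4 / a ≤ x := by linarith
      rwa [div_le_iff₀' ha] at this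
    have hexp := Real.quadratic_le_exp_of_nonneg hx0.le
    have hsqrt : 1 ≤ √2 := Real.one_le_sqrt.2 (by norm_num)
    rw [Real.exp_neg, sub_nonpos, ← div_eq_mul_inv, div_le_iff₀ (Real.exp_pos x)]
    calc x ≤ a * x * (x / 4) := by nlinarith
      _ = a * (1 / 2) * (x ^ 2 / 2) := by ring
      _ ≤ a * (√2 / 2) * Real.exp x := by gcongr; linarith
  have hright : 0 < F (Real.pi / 2) := by
    simp only [F, Real.cos_pi_div_two, Real.sin_pi_div_two, zero_div, mul_zero, Real.exp_zero]
    linarith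
  obtain ⟨s, hs, hFs⟩ := intermediate_value_Icc (by linarith) hF ⟨hleft, hright.le⟩
  have hlt : s < Real.pi / 2 := hs.2.lt_of_ne (by rintro rfl; exact hright.ne' hFs)
  exact ⟨s, hsin s hs, Real.cos_pos_of_mem_Ioo ⟨by linarith [hs.1], hlt⟩,
    by linarith [hs.1], sub_eq_zero.1 hFs⟩

theorem exists_solution_of_pos {a : ℝ} (b : ℝ) (ha : 0 < a) :
    ∃ ξ₁ ξ₂ : ℝ, ξ₁ < 0 ∧ 0 < ξ₂ ∧
      ξ₁ * Real.exp ξ₁ = a * Real.cos (ξ₂ - b) ∧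
      ξ₂ * Real.exp ξ₁ = -a * Real.sin (ξ₂ - b) := by
  obtain ⟨n, hn⟩ := exists_nat_ge ((a + 4 / a - b - Real.pi) / (2 * Real.pi))
  rw [div_le_iff₀ (by positivity)] at hn
  set c := b + Real.pi + n * (2 * Real.pi) with hc
  obtain ⟨s, hsin, hcos, hpos, heq⟩ := exists_modulus_eq (c := c) ha (by linarith)
  have hphase : c + s - b = s + Real.pi + n * (2 * Real.pi) := by rw [hc]; ring
  refine ⟨-(c + s) * (Real.cos s / Real.sin s), c + s, ?_, hpos, ?_, ?_⟩
  · rw [neg_mul, neg_lt_zero]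
    positivity
  · rw [hphase, Real.cos_add_nat_mul_two_pi, Real.cos_add_pi, mul_right_comm, neg_mul, heq]
    field_simp
  · rw [hphase, Real.sin_add_nat_mul_two_pi, Real.sin_add_pi, heq]
    ring


/-- Solvability of the real system (9.6.2) in the proof of Lemma 3.1: for every
nonzero real `a` and every `b ∈ ℝ` there exist `ξ₁ < 0` and `ξ₂ > 0` with
`ξ₁ e^{ξ₁} = a cos(ξ₂ - b)` and `ξ₂ e^{ξ₁} = -a sin(ξ₂ - b)`. -/
theorem stmt_4 (a b : ℝ) (ha : a ≠ 0) :
    ∃ ξ₁ ξ₂ : ℝ, ξ₁ < 0 ∧ 0 < ξ₂ ∧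
      ξ₁ * Real.exp ξ₁ = a * Real.cos (ξ₂ - b) ∧
      ξ₂ * Real.exp ξ₁ = -a * Real.sin (ξ₂ - b) := by
  rcases ha.lt_or_gt with h | h
  · obtain ⟨ξ₁, ξ₂, h₁, h₂, hcos, hsin⟩ := exists_solution_of_pos (b - Real.pi) (neg_pos.2 h)
    rw [sub_sub_eq_add_sub, add_sub_right_comm] at hcos hsin
    rw [Real.cos_add_pi, neg_mul_neg] at hcos
    rw [Real.sin_add_pi, neg_neg, mul_neg, ← neg_mul] at hsin
    exact ⟨ξ₁, ξ₂, h₁, h₂, hcos, hsin⟩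
  · exact exists_solution_of_pos b h
end

section
/- Let a be a nonzero real number and b ∈ ℝ. Then there exist real numbers ξ₁ < 0 and ξ₂ > 0 with ξ₁² + ξ₂² = a²·exp(-2ξ₁) and ξ₁·sin(ξ₂ - b) = -ξ₂·cos(ξ₂ - b), such that moreover: if a > 0 then cos(ξ₂ - b) < 0 and sin(ξ₂ - b) < 0, while if a < 0 then cos(ξ₂ - b) > 0 and sin(ξ₂ - b) > 0. -/
open Real Set Filter Topology in
theorem exists_add_eq_mul_sin_mul_exp_cot {A c : ℝ} (hA : 0 < A) (hc : 1 ≤ c) (hAc : A < c) :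
    ∃ φ ∈ Ioo 0 (π / 2), c + φ = A * (sin φ * exp ((c + φ) * (cos φ / sin φ))) := by
  obtain ⟨φ₀, hφ₀, hφ₀π, hsmall⟩ :
      ∃ φ₀ : ℝ, 0 < φ₀ ∧ φ₀ < π / 2 ∧ 2 * sin φ₀ < A * cos φ₀ ^ 2 := by
    have h₁ : ∀ᶠ φ in 𝓝[>] (0 : ℝ), 2 * sin φ < A * cos φ ^ 2 :=
      nhdsWithin_le_nhds <| ContinuousAt.eventually_lt (by fun_prop) (by fun_prop) (by simpa using hA)
    have h₂ : ∀ᶠ φ in 𝓝[>] (0 : ℝ), φ ∈ Ioo 0 (π / 2) :=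
      Ioo_mem_nhdsGT (by positivity)
    obtain ⟨φ, h, hφ⟩ := (h₁.and h₂).exists
    exact ⟨φ, hφ.1, hφ.2, h⟩
  have hsin : ∀ φ ∈ Icc φ₀ (π / 2), 0 < sin φ := fun φ hφ ↦
    sin_pos_of_pos_of_lt_pi (hφ₀.trans_le hφ.1) (by linarith [hφ.2, pi_pos])
  have hcont : ContinuousOn
      (fun φ ↦ c + φ - A * (sin φ * exp ((c + φ) * (cos φ / sin φ)))) (Icc φ₀ (π / 2)) := by
    have hcot : ContinuousOn (fun φ ↦ cos φ / sin φ) (Icc φ₀ (π / 2)) :=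
      continuousOn_cos.div continuousOn_sin fun φ hφ ↦ (hsin φ hφ).ne'
    fun_prop
  have hleft : c + φ₀ - A * (sin φ₀ * exp ((c + φ₀) * (cos φ₀ / sin φ₀))) < 0 := by
    have hs := hsin φ₀ ⟨le_rfl, hφ₀π.le⟩
    have hcos : 0 < cos φ₀ := cos_pos_of_mem_Ioo ⟨by linarith, hφ₀π⟩
    have hy : 1 < c + φ₀ := by linarith
    set y := c + φ₀
    have hexp : (y * (cos φ₀ / sin φ₀)) ^ 2 / 2 < exp (y * (cos φ₀ / sin φ₀)) := by
      have := quadratic_le_exp_of_nonneg (x := y * (cos φ₀ / sin φ₀)) (by positivity)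
      have : 0 < y * (cos φ₀ / sin φ₀) := by positivity
      linarith
    have hlow : y < A * (sin φ₀ * ((y * (cos φ₀ / sin φ₀)) ^ 2 / 2)) := by
      have : A * (sin φ₀ * ((y * (cos φ₀ / sin φ₀)) ^ 2 / 2)) =
          y ^ 2 * (A * cos φ₀ ^ 2) / (2 * sin φ₀) := by
        field_simp
      rw [this, lt_div_iff₀ (by positivity)]
      calc y * (2 * sin φ₀) < y * (A * cos φ₀ ^ 2) := by gcongr
        _ ≤ y ^ 2 * (A * cos φ₀ ^ 2) := by
          gcongr
          nlinarith
    have : A * (sin φ₀ * ((y * (cos φ₀ / sin φ₀)) ^ 2 / 2)) <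
        A * (sin φ₀ * exp (y * (cos φ₀ / sin φ₀))) := by gcongr
    linarith
  have hright : 0 < c + π / 2 -
      A * (sin (π / 2) * exp ((c + π / 2) * (cos (π / 2) / sin (π / 2)))) := by
    simp only [sin_pi_div_two, cos_pi_div_two, zero_div, mul_zero, exp_zero, mul_one]
    linarith [pi_pos]
  obtain ⟨φ, hφ, h⟩ := intermediate_value_Ioo hφ₀π.le hcont ⟨hleft, hright⟩
  exact ⟨φ, ⟨hφ₀.trans hφ.1, hφ.2⟩, sub_eq_zero.mp h⟩

open Real Set in
theorem exists_sq_add_sq_eq_of_shift (a b s : ℝ) (ha : a ≠ 0) :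
    ∃ x y φ : ℝ, ∃ k : ℕ, 0 < x ∧ 0 < y ∧ φ ∈ Ioo 0 (π / 2) ∧ y - b = φ + s + k * (2 * π) ∧
      x ^ 2 + y ^ 2 = a ^ 2 * exp (2 * x) ∧ x * sin φ = y * cos φ := by
  obtain ⟨k, hk⟩ := exists_nat_gt (1 + |a| - b - s)
  have hkπ : (k : ℝ) ≤ k * (2 * π) :=
    le_mul_of_one_le_right k.cast_nonneg (by linarith [pi_gt_three])
  have ha' := abs_pos.mpr ha
  obtain ⟨φ, hφ, h⟩ := exists_add_eq_mul_sin_mul_exp_cot (c := b + s + k * (2 * π)) ha'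
    (by linarith) (by linarith)
  have hs : 0 < sin φ := sin_pos_of_pos_of_lt_pi hφ.1 (by linarith [hφ.2, pi_pos])
  have hc : 0 < cos φ := cos_pos_of_mem_Ioo ⟨by linarith [hφ.1, pi_pos], hφ.2⟩
  have hy : 0 < b + s + k * (2 * π) + φ := by linarith [hφ.1]
  refine ⟨(b + s + k * (2 * π) + φ) * (cos φ / sin φ), b + s + k * (2 * π) + φ, φ, k,
    by positivity, hy, hφ, by ring, ?_, by field_simp⟩
  set y := b + s + k * (2 * π) + φ
  set E := exp (y * (cos φ / sin φ)) with hE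
  have hexp : exp (2 * (y * (cos φ / sin φ))) = E ^ 2 := by
    rw [hE, ← exp_nat_mul]; norm_num
  have hsq : y ^ 2 = a ^ 2 * (sin φ ^ 2 * E ^ 2) := by
    rw [← sq_abs a, h]; ring
  calc (y * (cos φ / sin φ)) ^ 2 + y ^ 2 = y ^ 2 * (sin φ ^ 2 + cos φ ^ 2) / sin φ ^ 2 := by
        field_simp; ring
    _ = a ^ 2 * exp (2 * (y * (cos φ / sin φ))) := by
        rw [sin_sq_add_cos_sq, hexp, hsq]; field_simp

/-- Existence of the point `(ξ₁*, ξ₂*)` with prescribed sign pattern in the final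
step of the proof of Lemma 3.1. -/
theorem stmt_5 (a b : ℝ) (ha : a ≠ 0) :
    ∃ ξ₁ ξ₂ : ℝ, ξ₁ < 0 ∧ 0 < ξ₂ ∧
      ξ₁ ^ 2 + ξ₂ ^ 2 = a ^ 2 * Real.exp (-2 * ξ₁) ∧
      ξ₁ * Real.sin (ξ₂ - b) = -ξ₂ * Real.cos (ξ₂ - b) ∧
      (0 < a → Real.cos (ξ₂ - b) < 0 ∧ Real.sin (ξ₂ - b) < 0) ∧
      (a < 0 → 0 < Real.cos (ξ₂ - b) ∧ 0 < Real.sin (ξ₂ - b)) := by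
  open Real in
  rcases lt_or_gt_of_ne ha with ha' | ha'
  · obtain ⟨x, y, φ, k, hx, hy, hφ, hyb, hsq, htan⟩ := exists_sq_add_sq_eq_of_shift a b 0 ha
    have hs : 0 < sin φ := sin_pos_of_pos_of_lt_pi hφ.1 (by linarith [hφ.2, pi_pos])
    have hc : 0 < cos φ := cos_pos_of_mem_Ioo ⟨by linarith [hφ.1, pi_pos], hφ.2⟩
    have hsin : sin (y - b) = sin φ := by rw [hyb, sin_add_nat_mul_two_pi, add_zero]
    have hcos : cos (y - b) = cos φ := by rw [hyb, cos_add_nat_mul_two_pi, add_zero]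
    refine ⟨-x, y, by linarith, hy, by simpa using hsq, ?_, fun h ↦ absurd h ha'.not_gt, fun _ ↦ ?_⟩
    · rw [hsin, hcos]; linarith
    · rw [hsin, hcos]; exact ⟨hc, hs⟩
  · obtain ⟨x, y, φ, k, hx, hy, hφ, hyb, hsq, htan⟩ := exists_sq_add_sq_eq_of_shift a b π ha
    have hs : 0 < sin φ := sin_pos_of_pos_of_lt_pi hφ.1 (by linarith [hφ.2, pi_pos])
    have hc : 0 < cos φ := cos_pos_of_mem_Ioo ⟨by linarith [hφ.1, pi_pos], hφ.2⟩
    have hsin : sin (y - b) = -sin φ := by rw [hyb, sin_add_nat_mul_two_pi, sin_add_pi]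
    have hcos : cos (y - b) = -cos φ := by rw [hyb, cos_add_nat_mul_two_pi, cos_add_pi]
    refine ⟨-x, y, by linarith, hy, by simpa using hsq, ?_, fun _ ↦ ?_, fun h ↦ absurd h ha'.not_gt⟩
    · rw [hsin, hcos]; linarith
    · rw [hsin, hcos]; exact ⟨by linarith, by linarith⟩
end

section
/- Let a be a nonzero real number and b ∈ ℝ. Then there exists j* ∈ ℕ such that for every integer j ≥ j*, there is exactly one pair (ξ₁, ξ₂) ∈ ℝ² satisfying ξ₁ < 0, ξ₂ ∈ [jπ + b, (j+1)π + b), ξ₁² + ξ₂² = a²·exp(-2ξ₁), and ξ₁·sin(ξ₂ - b) = -ξ₂·cos(ξ₂ - b); moreover this unique pair satisfies ξ₂ > 0 and jπ + b < ξ₂ < (j + 1/2)π + b. -/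
open Real

/-- Shifting the phase by an integer multiple of `π` does not change the equation
`x sin t = -y cos t`. -/
lemma mul_sin_eq_neg_mul_cos_sub_int_mul_pi_iff (x y b : ℝ) (j : ℤ) :
    x * sin (y - b) = -y * cos (y - b) ↔
      x * sin (y - (j * π + b)) = -y * cos (y - (j * π + b)) := by
  have h : y - b = (y - (j * π + b)) + j * π := by ring
  have hne : ((-1 : ℝ) ^ j) ≠ 0 := zpow_ne_zero _ (by norm_num)
  rw [h, sin_add_int_mul_pi, cos_add_int_mul_pi, mul_left_comm, mul_left_comm (-y)]
  exact mul_right_inj' hne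

lemma mem_Ioo_of_mul_sin_eq_neg_mul_cos {x y s : ℝ} (hx : x < 0) (hy : 0 < y)
    (hs : s ∈ Set.Ico 0 π) (h : x * sin s = -y * cos s) : s ∈ Set.Ioo 0 (π / 2) := by
  obtain ⟨h0, hπ⟩ := hs
  have hpos : 0 < s := by
    refine h0.lt_of_ne ?_
    rintro rfl
    simp at h
    linarith
  refine ⟨hpos, ?_⟩
  by_contra! hge
  have h1 : 0 < sin s := sin_pos_of_pos_of_lt_pi hpos hπ
  have h2 : cos s ≤ 0 := cos_nonpos_of_pi_div_two_le_of_le hge (by linarith)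
  nlinarith [mul_neg_of_neg_of_pos hx h1, mul_nonneg hy.le (neg_nonneg.2 h2)]

/-- Along `x sin s = (c + s) cos s` with `c` large, `x` strictly decreases in `s`. -/
lemma lt_of_mul_sin_eq_add_mul_cos {c s t x z : ℝ} (hc : 2 ≤ c) (hs : 0 < s) (hst : s < t)
    (ht : t < π / 2) (h₁ : x * sin s = (c + s) * cos s)
    (h₂ : z * sin t = (c + t) * cos t) : z < x := by
  by_contra! hxz
  have hd : 0 < t - s := by linarith
  have hsin : 2 / π * (t - s) ≤ sin (t - s) := mul_le_sin hd.le (by linarith)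
  have hs0 : 0 < sin s := sin_pos_of_pos_of_lt_pi hs (by linarith)
  have ht0 : 0 < sin t := sin_pos_of_pos_of_lt_pi (by linarith) (by linarith)
  have key : (c + s) * (c + t) * sin (t - s)
      = sin s * sin t * (x * (c + t) - z * (c + s)) := by
    rw [sin_sub]
    linear_combination (-(c + t) * sin t) * h₁ + ((c + s) * sin s) * h₂
  have hle : x * (c + t) - z * (c + s) ≤ x * (t - s) := by nlinarith
  have hcs : cos s * sin t ≤ 1 := mul_le_one₀ (cos_le_one s) ht0.le (sin_le_one t)
  have h3 : (c + s) * ((c + t) * sin (t - s)) ≤ (c + s) * (t - s) := by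
    calc (c + s) * ((c + t) * sin (t - s))
        = sin s * sin t * (x * (c + t) - z * (c + s)) := by rw [← key]; ring
      _ ≤ sin s * sin t * (x * (t - s)) := by gcongr
      _ = (c + s) * (t - s) * (cos s * sin t) := by linear_combination (sin t * (t - s)) * h₁
      _ ≤ (c + s) * (t - s) * 1 := by gcongr
      _ = _ := mul_one _
  have h4 : (c + t) * sin (t - s) ≤ t - s := le_of_mul_le_mul_left h3 (by linarith)
  have h5 : (c + t) * (2 / π) * (t - s) ≤ 1 * (t - s) := by
    rw [mul_assoc, one_mul]
    exact (mul_le_mul_of_nonneg_left hsin (by linarith)).trans h4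
  have h6 := le_of_mul_le_mul_right h5 hd
  rw [mul_div_assoc', div_le_one pi_pos] at h6
  linarith [pi_lt_four]

/-- On the curve `x² + y² = a² exp (2x)`, in the region `x ≥ 0`, `y ≥ 1`, the ordinate is a
monotone function of the abscissa. -/
lemma le_of_sq_add_sq_eq_mul_exp {a x y z w : ℝ} (hz : 0 ≤ z) (hy : 0 ≤ y) (hw : 1 ≤ w)
    (hzx : z < x) (h₁ : x ^ 2 + y ^ 2 = a ^ 2 * exp (2 * x))
    (h₂ : z ^ 2 + w ^ 2 = a ^ 2 * exp (2 * z)) : w ≤ y := by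
  by_contra! hyw
  have hd : 0 < x - z := by linarith
  have hexp : 1 + 2 * (x - z) + (2 * (x - z)) ^ 2 / 2 ≤ exp (2 * (x - z)) :=
    quadratic_le_exp_of_nonneg (by linarith)
  have hprod : x ^ 2 + y ^ 2 = (z ^ 2 + w ^ 2) * exp (2 * (x - z)) := by
    rw [h₁, h₂, mul_assoc, ← exp_add]
    ring_nf
  have h3 : (z ^ 2 + w ^ 2) * (1 + 2 * (x - z) + (2 * (x - z)) ^ 2 / 2) ≤ x ^ 2 + y ^ 2 := by
    rw [hprod]
    gcongr
  have hyw2 : y ^ 2 < w ^ 2 := by gcongr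
  have hR : z ^ 2 + 1 ≤ z ^ 2 + w ^ 2 := by nlinarith
  have h4 : (z ^ 2 + 1) * (2 * (x - z) + (2 * (x - z)) ^ 2 / 2)
      ≤ (z ^ 2 + w ^ 2) * (2 * (x - z) + (2 * (x - z)) ^ 2 / 2) := by gcongr
  nlinarith [mul_nonneg hd.le (sq_nonneg (z - 1)), sq_nonneg (z * (x - z)), mul_nonneg hd.le hz,
    mul_nonneg hd.le (sq_nonneg z), sq_pos_of_pos hd]

lemma eq_of_mem_curves {a c x s z t : ℝ} (hc : 2 ≤ c) (hx : 0 < x) (hz : 0 < z)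
    (hs : s ∈ Set.Ioo 0 (π / 2)) (ht : t ∈ Set.Ioo 0 (π / 2))
    (hA₁ : x ^ 2 + (c + s) ^ 2 = a ^ 2 * exp (2 * x))
    (hA₂ : z ^ 2 + (c + t) ^ 2 = a ^ 2 * exp (2 * z))
    (hB₁ : x * sin s = (c + s) * cos s) (hB₂ : z * sin t = (c + t) * cos t) :
    x = z ∧ s = t := by
  obtain ⟨hs0, hs1⟩ := hs
  obtain ⟨ht0, ht1⟩ := ht
  rcases lt_trichotomy s t with h | rfl | h
  · have := lt_of_mul_sin_eq_add_mul_cos hc hs0 h ht1 hB₁ hB₂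
    linarith [le_of_sq_add_sq_eq_mul_exp hz.le (by linarith) (by linarith) this hA₁ hA₂]
  · have hsin : sin s ≠ 0 := (sin_pos_of_pos_of_lt_pi hs0 (by linarith)).ne'
    exact ⟨mul_right_cancel₀ hsin (hB₁.trans hB₂.symm), rfl⟩
  · have := lt_of_mul_sin_eq_add_mul_cos hc ht0 h hs1 hB₂ hB₁
    linarith [le_of_sq_add_sq_eq_mul_exp hx.le (by linarith) (by linarith) this hA₂ hA₁]

lemma exists_mem_curves {a c : ℝ} (ha : a ≠ 0) (hc : 2 + |a| + 4 / |a| ≤ c) :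
    ∃ x > 0, ∃ s ∈ Set.Ioo 0 (π / 2), x ^ 2 + (c + s) ^ 2 = a ^ 2 * exp (2 * x) ∧
      x * sin s = (c + s) * cos s := by
  have ha0 : 0 < |a| := abs_pos.2 ha
  have hdiv : 0 < 4 / |a| := by positivity
  have hπ := pi_pos
  let G : ℝ → ℝ := fun s ↦ (c + s) * exp (-((c + s) * cos s / sin s)) - |a| * sin s
  have hG : ContinuousOn G (Set.Icc (π / 4) (π / 2)) := by
    have hsin : ∀ s ∈ Set.Icc (π / 4) (π / 2), sin s ≠ 0 := fun s hs ↦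
      (sin_pos_of_pos_of_lt_pi (by linarith [hs.1]) (by linarith [hs.2])).ne'
    have hq : ContinuousOn (fun s ↦ (c + s) * cos s / sin s) (Set.Icc (π / 4) (π / 2)) :=
      ContinuousOn.div (by fun_prop) (by fun_prop) hsin
    fun_prop
  have hleft : G (π / 4) < 0 := by
    set y := c + π / 4 with hy
    have hypos : 0 < y := by linarith
    have hay : 4 ≤ y * |a| := by
      rw [← div_le_iff₀ ha0]
      linarith
    have hexp : y ^ 2 / 2 < exp y := by
      linarith [quadratic_le_exp_of_nonneg hypos.le]
    have hsqrt : 1 ≤ √2 := one_le_sqrt.2 (by norm_num)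
    have hsq : (√2 / 2 : ℝ) ≠ 0 := by positivity
    have hval : G (π / 4) = y * exp (-y) - |a| * (√2 / 2) := by
      simp only [G, cos_pi_div_four, sin_pi_div_four, ← hy]
      rw [mul_div_cancel_right₀ _ hsq]
    have h1 : y < |a| / 2 * exp y := by
      calc y = y * 4 / 4 := by ring
        _ ≤ y * (y * |a|) / 4 := by gcongr
        _ = |a| / 2 * (y ^ 2 / 2) := by ring
        _ < _ := by gcongr
    have h2 : y * exp (-y) < |a| / 2 := by
      rw [exp_neg, ← div_eq_mul_inv, div_lt_iff₀ (exp_pos y)]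
      exact h1
    rw [hval]
    nlinarith
  have hright : 0 < G (π / 2) := by
    simp only [G, cos_pi_div_two, sin_pi_div_two]
    simp
    linarith
  obtain ⟨s, ⟨hs4, hs2⟩, hs⟩ := intermediate_value_Ioo (by linarith) hG ⟨hleft, hright⟩
  have hsin : 0 < sin s := sin_pos_of_pos_of_lt_pi (by linarith) (by linarith)
  have hcos : 0 < cos s := cos_pos_of_mem_Ioo ⟨by linarith, hs2⟩
  have hy : 0 < c + s := by linarith
  have hB : (c + s) * cos s / sin s * sin s = (c + s) * cos s := div_mul_cancel₀ _ hsin.ne'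
  refine ⟨(c + s) * cos s / sin s, by positivity, s, ⟨by linarith, hs2⟩, ?_, hB⟩
  simp only [G] at hs
  set x := (c + s) * cos s / sin s
  have hE : c + s = |a| * sin s * exp x := by
    rw [exp_neg, ← div_eq_mul_inv, sub_eq_zero, div_eq_iff (exp_pos x).ne'] at hs
    exact hs
  have hexp : exp (2 * x) = exp x ^ 2 := by rw [← exp_nat_mul]; norm_num
  have hsq : (x ^ 2 + (c + s) ^ 2) * sin s ^ 2 = (c + s) ^ 2 := by
    linear_combination (x * sin s + (c + s) * cos s) * hB + (c + s) ^ 2 * sin_sq_add_cos_sq s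
  refine mul_right_cancel₀ (pow_ne_zero 2 hsin.ne') (hsq.trans ?_)
  rw [hexp, ← sq_abs a]
  linear_combination (c + s + |a| * sin s * exp x) * hE

/-- Claims (a₃) and (9.14.3) in the proof of Lemma 3.1: for all large enough
integers `j` there is exactly one pair `(ξ₁, ξ₂)` with `ξ₁ < 0`,
`ξ₂ ∈ [jπ + b, (j+1)π + b)` on the curves `𝔸` and `𝔹`, and it satisfies
`ξ₂ > 0` and `jπ + b < ξ₂ < (j + 1/2)π + b`. -/
theorem stmt_6 (a b : ℝ) (ha : a ≠ 0) :
    ∃ jstar : ℕ, ∀ j : ℤ, (jstar : ℤ) ≤ j →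
      (∃! p : ℝ × ℝ, p.1 < 0 ∧ p.2 ∈ Set.Ico ((j : ℝ) * π + b) (((j : ℝ) + 1) * π + b) ∧
          p.1 ^ 2 + p.2 ^ 2 = a ^ 2 * Real.exp (-2 * p.1) ∧
          p.1 * Real.sin (p.2 - b) = -p.2 * Real.cos (p.2 - b)) ∧
      (∀ p : ℝ × ℝ, p.1 < 0 → p.2 ∈ Set.Ico ((j : ℝ) * π + b) (((j : ℝ) + 1) * π + b) →
          p.1 ^ 2 + p.2 ^ 2 = a ^ 2 * Real.exp (-2 * p.1) →
          p.1 * Real.sin (p.2 - b) = -p.2 * Real.cos (p.2 - b) →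
          0 < p.2 ∧ (j : ℝ) * π + b < p.2 ∧ p.2 < ((j : ℝ) + 1 / 2) * π + b) := by
  obtain ⟨n, hn⟩ := exists_nat_ge ((2 + |a| + 4 / |a| - b) / π)
  refine ⟨n, fun j hj ↦ ?_⟩
  have hπ := pi_pos
  have ha0 : 0 < |a| := abs_pos.2 ha
  have hdiv : 0 < 4 / |a| := by positivity
  have hjn : (n : ℝ) ≤ j := by exact_mod_cast hj
  have hcM : 2 + |a| + 4 / |a| ≤ j * π + b := by
    rw [div_le_iff₀ hπ] at hn
    nlinarith
  simp only [fun x y ↦ mul_sin_eq_neg_mul_cos_sub_int_mul_pi_iff x y b j]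
  have hright : ((j : ℝ) + 1) * π + b = j * π + b + π := by ring
  have hmid : ((j : ℝ) + 1 / 2) * π + b = j * π + b + π / 2 := by ring
  rw [hright, hmid]
  generalize (j : ℝ) * π + b = c at hcM ⊢
  have hc : 2 ≤ c := by linarith
  have hmem : ∀ p : ℝ × ℝ, p.1 < 0 → p.2 ∈ Set.Ico c (c + π) →
      p.1 * sin (p.2 - c) = -p.2 * cos (p.2 - c) → p.2 - c ∈ Set.Ioo 0 (π / 2) :=
    fun p h1 h2 h3 ↦ mem_Ioo_of_mul_sin_eq_neg_mul_cos h1 (by linarith [h2.1])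
      ⟨by linarith [h2.1], by linarith [h2.2]⟩ h3
  refine ⟨?_, fun p h1 h2 _ h3 ↦ ?_⟩
  · obtain ⟨x, hx, s, hs, hA, hB⟩ := exists_mem_curves ha hcM
    refine ⟨(-x, c + s), ⟨by simpa using hx, ⟨by linarith [hs.1], by linarith [hs.2]⟩, ?_, ?_⟩, ?_⟩
    · simpa using hA
    · simp only [add_sub_cancel_left]
      linarith
    · rintro ⟨u, v⟩ ⟨h1, h2, hA', hB'⟩
      have hm := hmem _ h1 h2 hB'
      simp only at h1 h2 hA' hB' hm
      obtain ⟨h3, h4⟩ := eq_of_mem_curves (a := a) (x := -u) hc (by linarith) hx hm hs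
        (by rw [add_sub_cancel, neg_sq, hA']; ring_nf) hA
        (by rw [add_sub_cancel]; linarith) hB
      ext
      · simp only; linarith
      · simp only; linarith
  · have hm := hmem p h1 h2 h3
    exact ⟨by linarith [h2.1], by linarith [hm.1], by linarith [hm.2]⟩
end

section
/- Let b ∈ ℝ and let j be an integer with jπ + b ≥ 1. Then the function f_b(s) := -s·cos(s - b)/sin(s - b) is strictly increasing on the open interval (jπ + b, (j+1)π + b). -/
open Real

lemma sin_ne_zero_of_mem_Ioo_int_mul_pi {j : ℤ} {x : ℝ}
    (hx : x ∈ Set.Ioo ((j : ℝ) * π) (((j : ℝ) + 1) * π)) : Real.sin x ≠ 0 := by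
  intro h
  obtain ⟨n, rfl⟩ := Real.sin_eq_zero_iff.mp h
  have h1 : (j : ℝ) < n := lt_of_mul_lt_mul_right hx.1 pi_pos.le
  have h2 : (n : ℝ) < (j : ℝ) + 1 := lt_of_mul_lt_mul_right hx.2 pi_pos.le
  norm_cast at h1 h2
  omega

lemma hasDerivAt_neg_mul_cos_div_sin {b s : ℝ} (hs : Real.sin (s - b) ≠ 0) :
    HasDerivAt (fun s : ℝ => -s * Real.cos (s - b) / Real.sin (s - b))
      ((s - Real.sin (s - b) * Real.cos (s - b)) / Real.sin (s - b) ^ 2) s := by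
  have hb : HasDerivAt (fun s : ℝ => s - b) 1 s := (hasDerivAt_id s).sub_const b
  refine (((hasDerivAt_neg s).mul hb.cos).div hb.sin hs).congr_deriv ?_
  congr 1
  simp only [Pi.mul_apply]
  linear_combination s * Real.sin_sq_add_cos_sq (s - b)

/-- Property (a₂) in the proof of Lemma 3.1: the function
`f_b(s) = -s cos(s - b)/sin(s - b)` is strictly increasing on
`(jπ + b, (j+1)π + b)` when `jπ + b ≥ 1`. -/
theorem stmt_7 (b : ℝ) (j : ℤ) (hj : 1 ≤ (j : ℝ) * π + b) :
    StrictMonoOn (fun s : ℝ => -s * Real.cos (s - b) / Real.sin (s - b))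
      (Set.Ioo ((j : ℝ) * π + b) (((j : ℝ) + 1) * π + b)) := by
  have hsin : ∀ s ∈ Set.Ioo ((j : ℝ) * π + b) (((j : ℝ) + 1) * π + b), Real.sin (s - b) ≠ 0 :=
    fun s hs => sin_ne_zero_of_mem_Ioo_int_mul_pi
      ⟨lt_sub_iff_add_lt.mpr hs.1, sub_lt_iff_lt_add.mpr hs.2⟩
  refine strictMonoOn_of_deriv_pos (convex_Ioo _ _)
    (fun s hs => (hasDerivAt_neg_mul_cos_div_sin (hsin s hs)).continuousAt.continuousWithinAt) ?_
  rw [interior_Ioo]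
  intro s hs
  have h0 := hsin s hs
  rw [(hasDerivAt_neg_mul_cos_div_sin h0).deriv]
  refine div_pos ?_ (by positivity)
  nlinarith [hs.1, Real.sin_sq_add_cos_sq (s - b), sq_nonneg (Real.sin (s - b) - Real.cos (s - b))]
end

section
/- Let κ be a nonzero real number and τ > 0. Then for every complex number η there exists a complex number z with Re z < Re η and Im z < Im η such that z - κ·exp(-τz) = η. -/
open Filter Topology

/-- For every nonzero `c`, the equation `u * exp u = c` has a solution in the open third quadrant. -/
theorem exists_mul_exp_eq_re_neg_im_neg {c : ℂ} (hc : c ≠ 0) :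
    ∃ u : ℂ, u.re < 0 ∧ u.im < 0 ∧ u * Complex.exp u = c := by
  obtain ⟨l, rfl⟩ : ∃ l, Complex.exp l = c := ⟨Complex.log c, Complex.exp_log hc⟩
  set S : ℝ → ℝ := fun x => x * Real.exp (-(l.re + x)) with hS
  set Y : ℝ → ℝ := fun x => Real.exp (l.re + x) * Real.cos (Real.arcsin (S x)) with hY
  set F : ℝ → ℝ := fun x => Real.pi / 2 + Real.arcsin (S x) + Y x with hF
  have S_lim : Tendsto S atTop (𝓝 0) := by
    have h := (Real.tendsto_pow_mul_exp_neg_atTop_nhds_zero 1).const_mul (Real.exp (-l.re))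
    rw [mul_zero] at h
    refine h.congr fun x => ?_
    simp only [hS, neg_add, Real.exp_add]
    ring
  have arcsin_lim : Tendsto (fun x => Real.arcsin (S x)) atTop (𝓝 0) := by
    simpa [Function.comp_def] using (Real.continuous_arcsin.tendsto 0).comp S_lim
  have cos_lim : Tendsto (fun x => Real.cos (Real.arcsin (S x))) atTop (𝓝 1) := by
    simpa [Function.comp_def] using (Real.continuous_cos.tendsto 0).comp arcsin_lim
  have Y_lim : Tendsto Y atTop atTop :=
    (Real.tendsto_exp_atTop.comp (tendsto_atTop_add_const_left _ _ tendsto_id)).atTop_mul_pos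
      one_pos cos_lim
  have F_lim : Tendsto F atTop atTop :=
    (arcsin_lim.const_add (Real.pi / 2)).add_atTop Y_lim
  have F_cont : Continuous F := by
    simp only [hF, hY, hS]
    fun_prop
  obtain ⟨X, hX⟩ := eventually_atTop.1 <|
    (eventually_gt_atTop 0).and (S_lim.eventually (gt_mem_nhds one_pos))
  obtain ⟨k, hk⟩ := exists_nat_ge ((F X + l.im) / (2 * Real.pi))
  rw [div_le_iff₀ (by positivity)] at hk
  obtain ⟨X', hX', hXX'⟩ :=
    ((F_lim.eventually_ge_atTop (k * (2 * Real.pi) - l.im)).and (eventually_ge_atTop X)).exists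
  obtain ⟨x, hx, hFx⟩ := intermediate_value_Icc hXX' F_cont.continuousOn
    (show k * (2 * Real.pi) - l.im ∈ Set.Icc (F X) (F X') from ⟨by linarith, hX'⟩)
  obtain ⟨x_pos, S_lt⟩ := hX x hx.1
  have S_pos : 0 < S x := by positivity
  have sin_eq : Real.exp (l.re + x) * Real.sin (Real.arcsin (S x)) = x := by
    rw [Real.sin_arcsin (by linarith) S_lt.le]
    simp only [hS, Real.exp_neg]
    field_simp
  have Y_pos : 0 < Y x := by
    refine mul_pos (Real.exp_pos _) ?_
    rw [Real.cos_arcsin]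
    exact Real.sqrt_pos.2 (by nlinarith)
  set φ := Real.arcsin (S x) with hφ
  have hu : (⟨-x, -Y x⟩ : ℂ) =
      Complex.exp ((l.re + x : ℝ) + (-(Real.pi / 2 + φ) : ℝ) * Complex.I) := by
    apply Complex.ext
    · rw [Complex.exp_re]
      simp [-neg_add_rev, Real.cos_neg, add_comm (Real.pi / 2), Real.cos_add_pi_div_two]
      linarith
    · rw [Complex.exp_im]
      simp [-neg_add_rev, Real.sin_neg, add_comm (Real.pi / 2), Real.sin_add_pi_div_two, hY, ← hφ]
  refine ⟨⟨-x, -Y x⟩, neg_lt_zero.2 x_pos, neg_lt_zero.2 Y_pos, ?_⟩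
  nth_rewrite 1 [hu]
  rw [← Complex.exp_add, Complex.exp_eq_exp_iff_exists_int]
  refine ⟨-k, ?_⟩
  have hFx' : Real.pi / 2 + φ + Y x = k * (2 * Real.pi) - l.im := hFx
  apply Complex.ext
  · simp
  · simp
    linarith

/-- A strengthening of Lemma 3.1 implicit in its proof: for every `η ∈ ℂ` there
is a solution `z` of `z - κ e^{-τz} = η` with `Re z < Re η` and `Im z < Im η`. -/
theorem stmt_14 (κ τ : ℝ) (hκ : κ ≠ 0) (hτ : 0 < τ) (η : ℂ) :
    ∃ z : ℂ, z.re < η.re ∧ z.im < η.im ∧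
      z - (κ : ℂ) * Complex.exp (-((τ : ℂ) * z)) = η := by
  have hτ' : (τ : ℂ) ≠ 0 := Complex.ofReal_ne_zero.2 hτ.ne'
  obtain ⟨u, hre, him, hu⟩ := exists_mul_exp_eq_re_neg_im_neg
    (c := τ * κ * Complex.exp (-(τ * η)))
    (mul_ne_zero (mul_ne_zero hτ' (Complex.ofReal_ne_zero.2 hκ)) (Complex.exp_ne_zero _))
  refine ⟨η + u / τ, ?_, ?_, ?_⟩
  · simpa using div_neg_of_neg_of_pos hre hτ
  · simpa using div_neg_of_neg_of_pos him hτ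
  · have h : -((τ : ℂ) * (η + u / τ)) = -(τ * η) - u := by
      field_simp
      ring
    rw [h, Complex.exp_sub]
    have hexp := Complex.exp_ne_zero u
    generalize Complex.exp (-(τ * η)) = e at hu ⊢
    field_simp
    linear_combination hu
end
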